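/- arXiv:2503.09621 — 2 statements merged into one kernel-verified Lean document; each statement's English description precedes it below -/
import Mathlib

section
/- Let α : ℝ → ℝ be locally Lipschitz, strictly monotone increasing, with α(0) = 0 (an extended class-K function). Let h : ℝ → ℝ be differentiable with h′(t) ≥ −α(h(t)) for all t ≥ 0, and suppose h(0) ≥ 0. Then h(t) ≥ 0 for all t ≥ 0. -/
/-- Forward invariance of the 0-superlevel set under the CBF condition:
if α is a locally Lipschitz extended class-K function and h satisfies
h′(t) ≥ −α(h(t)) for t ≥ 0 with h(0) ≥ 0, then h(t) ≥ 0 for all t ≥ 0. -/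
theorem cbf_forward_invariance (α : ℝ → ℝ)
    (hα_lip : LocallyLipschitz α) (hα_mono : StrictMono α) (hα0 : α 0 = 0)
    (h : ℝ → ℝ) (hdiff : Differentiable ℝ h)
    (hineq : ∀ t : ℝ, 0 ≤ t → deriv h t ≥ -α (h t))
    (h0 : 0 ≤ h 0) :
    ∀ t : ℝ, 0 ≤ t → 0 ≤ h t := by
  intro t ht
  refine le_of_forall_pos_le_add fun ε hε => ?_
  have hle : -h t ≤ ε :=
    image_le_of_deriv_right_lt_deriv_boundary (f := fun x => -h x) (f' := fun x => -deriv h x)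
      (B := fun _ => ε) (B' := fun _ => 0) (a := 0) (b := t)
      hdiff.continuous.neg.continuousOn
      (fun x _ => (hdiff x).hasDerivAt.neg.hasDerivWithinAt)
      (by linarith) (fun x => hasDerivAt_const x ε)
      (fun x hx hxε => by
        have hneg : α (h x) < 0 := hα0 ▸ hα_mono (show h x < 0 by linarith)
        linarith [hineq x hx.1])
      ⟨ht, le_rfl⟩
  linarith
end

section
/- Let α : ℝ → ℝ be locally Lipschitz, strictly monotone increasing, with α(0) = 0 (an extended class-K function). Let h : ℝ → ℝ be differentiable with h′(t) ≥ −α(h(t)) for all t ≥ 0, and suppose h(0) > 0. Then h(t) > 0 for all t ≥ 0. -/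
/-- A locally Lipschitz function vanishing at `0` is bounded above by a linear function to the
right of `0`. -/
theorem LocallyLipschitz.exists_le_mul_of_map_zero {α : ℝ → ℝ} (hα : LocallyLipschitz α)
    (hα0 : α 0 = 0) :
    ∃ K : ℝ, 0 ≤ K ∧ ∃ δ > 0, ∀ x, 0 ≤ x → x < δ → α x ≤ K * x := by
  obtain ⟨K, t, ht, hK⟩ := hα 0
  obtain ⟨δ, hδ, hball⟩ := Metric.mem_nhds_iff.1 ht
  refine ⟨K, K.2, δ, hδ, fun x hx hxδ => ?_⟩
  have hxt : x ∈ t := hball (by simpa [abs_of_nonneg hx] using hxδ)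
  have hdist := hK.dist_le_mul x hxt 0 (mem_of_mem_nhds ht)
  rw [Real.dist_eq, Real.dist_eq, hα0, sub_zero, sub_zero, abs_of_nonneg hx] at hdist
  exact (le_abs_self _).trans hdist

/-- Strict forward invariance under the CBF condition:
if α is a locally Lipschitz extended class-K function and h satisfies
h′(t) ≥ −α(h(t)) for t ≥ 0 with h(0) > 0, then h(t) > 0 for all t ≥ 0. -/
theorem cbf_strict_forward_invariance (α : ℝ → ℝ)
    (hα_lip : LocallyLipschitz α) (hα_mono : StrictMono α) (hα0 : α 0 = 0)
    (h : ℝ → ℝ) (hdiff : Differentiable ℝ h)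
    (hineq : ∀ t : ℝ, 0 ≤ t → deriv h t ≥ -α (h t))
    (h0 : 0 < h 0) :
    ∀ t : ℝ, 0 ≤ t → 0 < h t := by
  obtain ⟨K, hK, δ, hδ, hle⟩ := hα_lip.exists_le_mul_of_map_zero hα0
  intro t ht
  obtain ⟨c, hc, hcmin⟩ := exists_between (lt_min h0 hδ)
  obtain ⟨hch, hcδ⟩ := lt_min_iff.1 hcmin
  -- The exponential `c * exp (-(K + 1) * s)` is a strict lower fence for `h`.
  have hderiv (s : ℝ) : HasDerivAt (fun s => c * Real.exp (-(K + 1) * s))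
      (-(K + 1) * (c * Real.exp (-(K + 1) * s))) s := by
    convert! (((hasDerivAt_id s).const_mul (-(K + 1))).exp).const_mul c using 1
    simp only [id]
    ring
  have hfence : c * Real.exp (-(K + 1) * t) ≤ h t := by
    refine image_le_of_deriv_right_lt_deriv_boundary
      (fun s _ => (hderiv s).continuousAt.continuousWithinAt)
      (fun s _ => (hderiv s).hasDerivWithinAt) (by simpa using hch.le)
      (fun s => (hdiff s).hasDerivAt) (fun s hs hEq => ?_) (Set.right_mem_Icc.2 ht)
    have hpos : 0 < c * Real.exp (-(K + 1) * s) := by positivity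
    have hexp : Real.exp (-(K + 1) * s) ≤ 1 := by
      rw [Real.exp_le_one_iff]
      nlinarith [mul_nonneg hK hs.1, hs.1]
    have hlt : c * Real.exp (-(K + 1) * s) < δ := (mul_le_of_le_one_right hc.le hexp).trans_lt hcδ
    have hs' := hineq s hs.1
    rw [← hEq] at hs'
    linarith [hle _ hpos.le hlt]
  exact lt_of_lt_of_le (by positivity) hfence
end
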